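/- Fix an integer ℓ ≥ 2 and v* ∈ ℝ, and for u < min(v*, 0) set r := (v* − u)/2 and ψ₀(u) := r^{ℓ−2} · (d/du)^{ℓ−2} ( f(u)·r^{−ℓ−3} ) (derivatives taken along the ingoing null cone v = v*, where dr/du = −1/2). If f(u) = c₁·u^{ℓ−1}·log(−u) for a constant c₁ ∈ ℝ, then lim_{u→−∞} r⁴·ψ₀(u)/log(−u) = ( (−1)^{ℓ−1}·(ℓ+1)!/3 )·c₁. In particular, the log-corrected multipole moments of hyperbolic Keplerian orbits produce a log r/r⁴ term in the expansion of Ψ₀ towards past null infinity, whose coefficient agrees, up to an ℓ-dependent nonzero multiple, with the coefficient of the r⁻⁴ term of Ψ₄. -/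

import Mathlib

noncomputable section
open Real Set Filter

/-- Iterated derivatives of negative powers of `r = (v − w)/2`. -/
lemma iteratedDeriv_radius_zpow (v : ℝ) (m i : ℕ) :
    iteratedDeriv i (fun w : ℝ => ((v - w) / 2) ^ (-(m : ℤ))) =
      fun w => (m.ascFactorial i : ℝ) / 2 ^ i * ((v - w) / 2) ^ (-(m : ℤ) - i) := by
  induction i with
  | zero => simp
  | succ i ih =>
    rw [iteratedDeriv_succ, ih]
    funext w
    have h : deriv (fun w : ℝ => ((v - w) / 2) ^ (-(m : ℤ) - i)) w =
        (-1 / 2) * deriv (fun x : ℝ => x ^ (-(m : ℤ) - i)) ((v - w) / 2) := by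
      have := deriv_comp_mul_left (-1 / 2 : ℝ) (fun y : ℝ => (y + v / 2) ^ (-(m : ℤ) - i)) w
      rw [deriv_comp_add_const (f := fun x : ℝ => x ^ (-(m : ℤ) - i)), smul_eq_mul] at this
      have e : ∀ x : ℝ, (v - x) / 2 = -1 / 2 * x + v / 2 := fun x => by ring
      simp only [e]
      exact this
    rw [deriv_const_mul_field, h, deriv_zpow, Nat.ascFactorial_succ]
    push_cast
    rw [show -(m : ℤ) - (i + 1) = -(m : ℤ) - i - 1 by ring]
    field_simp
    ring

lemma iteratedDeriv_succ_log_neg (i : ℕ) :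
    iteratedDeriv (i + 1) (fun w : ℝ => Real.log (-w)) =
      fun w => (-1) ^ i * (i.factorial : ℝ) * w ^ (-1 - i : ℤ) := by
  have h : deriv (fun w : ℝ => Real.log (-w)) = fun w => w⁻¹ := by
    simp only [Real.log_neg_eq_log]
    exact Real.deriv_log'
  rw [iteratedDeriv_succ', h, iteratedDeriv_eq_iterate, iter_deriv_inv']

lemma contDiffAt_radius_zpow {v u : ℝ} (hv : u < v) (m n : ℕ) :
    ContDiffAt ℝ n (fun w : ℝ => ((v - w) / 2) ^ (-(m : ℤ))) u := by
  simp only [zpow_neg, zpow_natCast]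
  have : ((v - u) / 2) ^ m ≠ 0 := pow_ne_zero _ (by linarith)
  exact ContDiffAt.inv (by fun_prop) this

lemma contDiffAt_log_neg {u : ℝ} (hu : u < 0) (n : ℕ) :
    ContDiffAt ℝ n (fun w : ℝ => Real.log (-w)) u :=
  ContDiffAt.log (by fun_prop) (by linarith)

lemma tendsto_radius_atBot (v : ℝ) : Tendsto (fun u : ℝ => (v - u) / 2) atBot atTop :=
  (tendsto_atTop_add_const_left _ v tendsto_neg_atBot_atTop).atTop_div_const two_pos

lemma tendsto_log_neg_atBot : Tendsto (fun u : ℝ => Real.log (-u)) atBot atTop :=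
  Real.tendsto_log_atTop.comp tendsto_neg_atBot_atTop

lemma tendsto_radius_div_atBot (v : ℝ) :
    Tendsto (fun u : ℝ => (v - u) / 2 / u) atBot (nhds (-1 / 2)) := by
  have h : Tendsto (fun u : ℝ => v / 2 * u⁻¹ + -1 / 2) atBot (nhds (v / 2 * 0 + -1 / 2)) :=
    (tendsto_inv_atBot_zero.const_mul _).add_const _
  rw [mul_zero, zero_add] at h
  refine h.congr' ?_
  filter_upwards [eventually_lt_atBot 0] with u hu
  have hu0 : u ≠ 0 := hu.ne
  field_simp
  ring

/-- The leading behaviour of the derivatives of `log(−w)·r^{−m}` is obtained by differentiating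
the power of `r` only. -/
lemma tendsto_iteratedDeriv_log_mul_radius_zpow (v : ℝ) (m n : ℕ) :
    Tendsto (fun u : ℝ => iteratedDeriv n
        (fun w => Real.log (-w) * ((v - w) / 2) ^ (-(m : ℤ))) u *
          ((v - u) / 2) ^ (m + n) / Real.log (-u)) atBot
      (nhds ((m.ascFactorial n : ℝ) / 2 ^ n)) := by
  have key : Tendsto (fun u : ℝ => (m.ascFactorial n : ℝ) / 2 ^ n +
      ∑ i ∈ Finset.range n, (n.choose (i + 1) : ℝ) * ((-1) ^ i * (i.factorial : ℝ)) *
        ((m.ascFactorial (n - (i + 1)) : ℝ) / 2 ^ (n - (i + 1))) *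
        ((v - u) / 2 / u) ^ (i + 1) * (Real.log (-u))⁻¹) atBot
      (nhds ((m.ascFactorial n : ℝ) / 2 ^ n + ∑ i ∈ Finset.range n,
        (n.choose (i + 1) : ℝ) * ((-1) ^ i * (i.factorial : ℝ)) *
        ((m.ascFactorial (n - (i + 1)) : ℝ) / 2 ^ (n - (i + 1))) *
        (-1 / 2) ^ (i + 1) * 0)) :=
    (tendsto_finsetSum _ fun i _ => (((tendsto_radius_div_atBot v).pow (i + 1)).const_mul _).mul
      (tendsto_inv_atTop_zero.comp tendsto_log_neg_atBot)).const_add _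
  simp only [mul_zero, Finset.sum_const_zero, add_zero] at key
  refine key.congr' ?_
  filter_upwards [eventually_lt_atBot v, eventually_lt_atBot (-1)] with u hv hu
  have hL : Real.log (-u) ≠ 0 := (Real.log_pos (by linarith)).ne'
  have hr : (v - u) / 2 ≠ 0 := by linarith
  have hu0 : u ≠ 0 := by linarith
  rw [iteratedDeriv_fun_mul (contDiffAt_log_neg (by linarith) n) (contDiffAt_radius_zpow hv m n),
    Finset.sum_range_succ', add_mul, add_div, add_comm, Finset.sum_mul, Finset.sum_div]
  congr 1
  · refine Finset.sum_congr rfl fun i hi => ?_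
    obtain ⟨k, rfl⟩ : ∃ k, n = k + (i + 1) :=
      ⟨n - (i + 1), by have := Finset.mem_range.mp hi; omega⟩
    rw [iteratedDeriv_succ_log_neg, iteratedDeriv_radius_zpow, Nat.add_sub_cancel]
    have h1 : u ^ (-1 - i : ℤ) = (u ^ (i + 1))⁻¹ := by
      rw [← zpow_natCast, ← zpow_neg]; congr 1; push_cast; ring
    have h2 : ((v - u) / 2) ^ (-(m : ℤ) - k) = (((v - u) / 2) ^ (m + k))⁻¹ := by
      rw [← zpow_natCast, ← zpow_neg]; congr 1; push_cast; ring
    beta_reduce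
    rw [h1, h2, div_pow _ u]
    generalize (v - u) / 2 = r at *
    field_simp
    ring
  · rw [iteratedDeriv_radius_zpow]
    have h2 : ((v - u) / 2) ^ (-(m : ℤ) - n) = (((v - u) / 2) ^ (m + n))⁻¹ := by
      rw [← zpow_natCast, ← zpow_neg]; congr 1; push_cast; ring
    simp only [Nat.choose_zero_right, iteratedDeriv_zero, Nat.sub_zero, h2]
    generalize (v - u) / 2 = r at *
    field_simp
    simp

/-- Binomial expansion of the multipole profile in powers of `r`. -/
lemma profile_eq_sum (v c w : ℝ) (n : ℕ) (hw : w < v) :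
    c * w ^ (n + 1) * Real.log (-w) * ((v - w) / 2) ^ (-((n + 2 : ℕ) : ℤ) - 3) =
      ∑ k ∈ Finset.range (n + 2), c * (v ^ k * (-2) ^ (n + 1 - k) * ((n + 1).choose k : ℝ)) *
        (Real.log (-w) * ((v - w) / 2) ^ (-((4 + k : ℕ) : ℤ))) := by
  have hr : (v - w) / 2 ≠ 0 := by linarith
  have hb : w ^ (n + 1) = ∑ k ∈ Finset.range (n + 2),
      v ^ k * (-2 * ((v - w) / 2)) ^ (n + 1 - k) * ((n + 1).choose k : ℝ) := by
    rw [← add_pow]; congr 1; ring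
  rw [hb, Finset.mul_sum, Finset.sum_mul, Finset.sum_mul]
  refine Finset.sum_congr rfl fun k hk => ?_
  have h : ((v - w) / 2) ^ (n + 1 - k) * ((v - w) / 2) ^ (-((n + 2 : ℕ) : ℤ) - 3) =
      ((v - w) / 2) ^ (-((4 + k : ℕ) : ℤ)) := by
    rw [← zpow_natCast, ← zpow_add₀ hr]
    congr 1
    have := Finset.mem_range.mp hk
    omega
  rw [← h, mul_pow]
  ring

/-- Minkowskian multipole-wave profile along an ingoing cone `v = v*` with
`r = (v* − u)/2` and `ψ₀(u) = r^{ℓ−2}·∂_u^{ℓ−2}(f(u)·r^{−ℓ−3})`: for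
`f(u) = c₁·u^{ℓ−1}·log(−u)`, `r⁴·ψ₀(u)/log(−u) → ((−1)^{ℓ−1}·(ℓ+1)!/3)·c₁` as
`u → −∞`: the log-corrected multipole moments produce a `log r/r⁴` term in `Ψ₀`
towards past null infinity. -/
theorem psi0_profile_log_term (ℓ : ℕ) (hℓ : 2 ≤ ℓ) (vstar : ℝ) (c₁ : ℝ) :
    Tendsto (fun u => ((vstar - u) / 2) ^ (4 : ℕ) * (((vstar - u) / 2) ^ ((ℓ : ℤ) - 2) *
        iteratedDeriv (ℓ - 2)
          (fun w => c₁ * w ^ (ℓ - 1) * Real.log (-w) * ((vstar - w) / 2) ^ (-(ℓ : ℤ) - 3))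
          u) / Real.log (-u)) atBot
      (nhds ((-1 : ℝ) ^ (ℓ - 1) * (Nat.factorial (ℓ + 1) : ℝ) / 3 * c₁)) := by
  obtain ⟨n, rfl⟩ : ∃ n, ℓ = n + 2 := ⟨ℓ - 2, by omega⟩
  set a : ℕ → ℝ := fun k => c₁ * (vstar ^ k * (-2) ^ (n + 1 - k) * ((n + 1).choose k : ℝ))
    with ha
  set F : ℕ → ℝ → ℝ := fun k w => Real.log (-w) * ((vstar - w) / 2) ^ (-((4 + k : ℕ) : ℤ))
  have key : Tendsto (fun u : ℝ => ∑ k ∈ Finset.range (n + 2), a k *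
      ((iteratedDeriv n (F k) u * ((vstar - u) / 2) ^ (4 + k + n) / Real.log (-u)) *
        (((vstar - u) / 2)⁻¹) ^ k)) atBot
      (nhds (∑ k ∈ Finset.range (n + 2), a k *
        (((4 + k).ascFactorial n : ℝ) / 2 ^ n * 0 ^ k))) :=
    tendsto_finsetSum _ fun k _ =>
      ((tendsto_iteratedDeriv_log_mul_radius_zpow vstar (4 + k) n).mul
        ((tendsto_inv_atTop_zero.comp (tendsto_radius_atBot vstar)).pow k)).const_mul _
  have hlim : ∑ k ∈ Finset.range (n + 2), a k *
      (((4 + k).ascFactorial n : ℝ) / 2 ^ n * 0 ^ k) =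
      (-1 : ℝ) ^ (n + 2 - 1) * (Nat.factorial (n + 2 + 1) : ℝ) / 3 * c₁ := by
    rw [Finset.sum_range_succ', Finset.sum_eq_zero (fun k _ => by simp), ← Nat.add_comm 3,
      show n + 2 + 1 = 3 + n by ring, ← Nat.factorial_mul_ascFactorial 3 n]
    have h2 : (-2 : ℝ) ^ (n + 1) = (-1) ^ (n + 1) * 2 ^ n * 2 := by
      rw [mul_assoc, ← pow_succ, ← mul_pow]; norm_num
    simp only [ha, pow_zero, Nat.sub_zero, Nat.choose_zero_right, h2]
    norm_num [Nat.factorial]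
    field_simp
    ring
  rw [hlim] at key
  refine key.congr' ?_
  filter_upwards [eventually_lt_atBot vstar, eventually_lt_atBot 0] with u hv hu
  have hr : (vstar - u) / 2 ≠ 0 := by linarith
  have hloc : (fun w : ℝ => c₁ * w ^ (n + 2 - 1) * Real.log (-w) *
      ((vstar - w) / 2) ^ (-((n + 2 : ℕ) : ℤ) - 3)) =ᶠ[nhds u]
      fun w => ∑ k ∈ Finset.range (n + 2), a k * F k w := by
    filter_upwards [eventually_lt_nhds hv] with w hw
    exact profile_eq_sum vstar c₁ w n hw
  have hFd : ∀ k, ContDiffAt ℝ n (F k) u := fun k =>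
    (contDiffAt_log_neg hu n).mul (contDiffAt_radius_zpow hv (4 + k) n)
  rw [Nat.add_sub_cancel, hloc.iteratedDeriv_eq,
    iteratedDeriv_fun_sum fun k _ => contDiffAt_const.mul (hFd k), Finset.mul_sum,
    Finset.mul_sum, Finset.sum_div]
  refine Finset.sum_congr rfl fun k _ => ?_
  rw [iteratedDeriv_const_mul_field,
    show ((n + 2 : ℕ) : ℤ) - 2 = (n : ℤ) by push_cast; ring, zpow_natCast, inv_pow]
  generalize (vstar - u) / 2 = r at *
  field_simp
  ring
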